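/- arXiv:1906.05281 — 2 statements merged into one kernel-verified Lean document; each statement's English description precedes it below -/
import Mathlib

section
/- Let (M,g) be a screen integrable null hypersurface of a Lorentzian manifold M̄(c) of constant sectional curvature c, and M* a leaf of S(TM) immersed in M̄ as a codimension-2 submanifold. Then for all X,Y ∈ Γ(TM*) and every normal vector field V to M*, the normal curvature satisfies R^{*⊥}(X,Y)V = {C(X,A_V Y) − C(Y,A_V X)}ξ + {B(X,A_V Y) − B(Y,A_V X)}N. -/
/-- Abstract Gauss–Weingarten data of a null hypersurface `(M,g)` of a Lorentzian
manifold `(M̄,ḡ)`, with a chosen screen distribution `S(TM)`, a null section `ξ`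
spanning `Rad TM = TM^⊥` and the corresponding unique null transversal section `N`,
together with the data of a fixed leaf `M*` of the screen distribution immersed in
`M̄` as a codimension-2 nondegenerate submanifold (its normal bundle being
`TM^{*⊥} = TM^⊥ ⊕ tr(TM)`, spanned by `ξ` and `N`).

Here `F` plays the role of the ring of smooth functions on `M`, `VF` plays the role
of the `F`-module of ambient vector fields along `M`, `tangent` is the predicate
"is a section of `TM`", and `screen` is the predicate "is a section of `S(TM)`"
(equivalently, for the fixed leaf, "is tangent to `M*`"). -/
structure ScreenNullHyp (F : Type*) [CommRing F]
    (VF : Type*) [AddCommGroup VF] [Module F VF] where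
  /-- sections of `TM` -/
  tangent : VF → Prop
  /-- sections of the screen distribution `S(TM)` (tangent fields of the leaf `M*`) -/
  screen : VF → Prop
  /-- the null section `ξ` spanning `TM^⊥` -/
  xi : VF
  /-- the null transversal section `N` spanning `tr(TM)` -/
  Ntr : VF
  /-- the ambient Lorentzian metric `ḡ` -/
  gbar : VF →ₗ[F] VF →ₗ[F] F
  /-- the action of a vector field on functions (directional derivative) -/
  act : VF → F → F
  /-- the Lie bracket of vector fields -/
  bracket : VF → VF → VF
  /-- the ambient Levi-Civita connection `∇̄` -/
  Dbar : VF → VF → VF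
  /-- the induced connection `∇` on `M` -/
  D : VF → VF → VF
  /-- the screen connection `∇*` -/
  Ds : VF → VF → VF
  /-- the normal connection `∇^{*⊥}` of the leaf `M*` in `M̄` -/
  Dperp : VF → VF → VF
  /-- the (local) second fundamental form `B` of `M` -/
  B : VF → VF → F
  /-- the (local) second fundamental form `C` of the screen distribution -/
  C : VF → VF → F
  /-- the shape operator `A_N` of `M` -/
  AN : VF → VF
  /-- the screen shape operator `A*_ξ` -/
  Axi : VF → VF
  /-- the shape operators of the leaf `M*`: `Ash V X = A_V X` for `V` normal to `M*` -/
  Ash : VF → VF → VF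
  /-- the transversal 1-form `τ` -/
  tau : VF → F
  /-- the projection `P : TM → S(TM)` -/
  P : VF → VF
  screen_tangent : ∀ X, screen X → tangent X
  tangent_xi : tangent xi
  gbar_symm : ∀ X Y, gbar X Y = gbar Y X
  /-- `ḡ(N,ξ) = 1` -/
  gbar_Ntr_xi : gbar Ntr xi = 1
  /-- `ḡ(N,N) = 0` -/
  gbar_Ntr_Ntr : gbar Ntr Ntr = 0
  /-- `ḡ(N,W) = 0` for every screen section `W` -/
  gbar_Ntr_screen : ∀ W, screen W → gbar Ntr W = 0
  /-- `ξ` is orthogonal to all of `TM` -/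
  gbar_xi_tangent : ∀ X, tangent X → gbar xi X = 0
  /-- the screen distribution is nondegenerate -/
  screen_nondeg : ∀ X, screen X → (∀ Y, screen Y → gbar X Y = 0) → X = 0
  /-- `∇̄` is a metric connection -/
  metric_compat : ∀ X Y Z, tangent X →
    act X (gbar Y Z) = gbar (Dbar X Y) Z + gbar Y (Dbar X Z)
  P_screen : ∀ X, tangent X → screen (P X)
  P_id : ∀ X, screen X → P X = X
  /-- `TM = S(TM) ⊥ TM^⊥` : `X = PX + η(X)ξ` with `η(X) = ḡ(N,X)` -/
  tangent_decomp : ∀ X, tangent X → X = P X + gbar Ntr X • xi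
  /-- Gauss formula: `∇̄_X Y = ∇_X Y + B(X,Y)N` -/
  gauss : ∀ X Y, tangent X → tangent Y → Dbar X Y = D X Y + B X Y • Ntr
  /-- Weingarten formula: `∇̄_X N = −A_N X + τ(X)N` -/
  weingarten_Ntr : ∀ X, tangent X → Dbar X Ntr = -AN X + tau X • Ntr
  /-- screen Gauss formula: `∇_X PY = ∇*_X PY + C(X,PY)ξ` -/
  gauss_screen : ∀ X Y, tangent X → tangent Y → D X (P Y) = Ds X (P Y) + C X (P Y) • xi
  /-- screen Weingarten formula: `∇_X ξ = −A*_ξ X − τ(X)ξ` -/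
  weingarten_xi : ∀ X, tangent X → D X xi = -Axi X - tau X • xi
  /-- `A*_ξ` is screen-valued -/
  Axi_screen : ∀ X, tangent X → screen (Axi X)
  /-- `A_N` is screen-valued -/
  AN_screen : ∀ X, tangent X → screen (AN X)
  /-- `A*_ξ ξ = 0` -/
  Axi_xi : Axi xi = 0
  /-- `g(A*_ξ X, Y) = B(X,Y)` -/
  B_shape : ∀ X Y, tangent X → tangent Y → gbar (Axi X) Y = B X Y
  /-- `g(A_N X, PY) = C(X,PY)` -/
  C_shape : ∀ X Y, tangent X → tangent Y → gbar (AN X) (P Y) = C X (P Y)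
  /-- the shape operators of the leaf are tangent to the leaf -/
  Ash_screen : ∀ V X, screen X → screen (Ash V X)
  /-- Weingarten formula of the leaf `M*` in `M̄`:
  `∇̄_X V = −A_V X + ∇^{*⊥}_X V` for `X` tangent to `M*` and `V` normal -/
  leaf_weingarten : ∀ X V, screen X → (∃ a b : F, V = a • xi + b • Ntr) →
    Dbar X V = -Ash V X + Dperp X V
  /-- the normal connection is valued in the normal bundle `TM^{*⊥}` -/
  Dperp_normal : ∀ X V, screen X → (∃ a b : F, V = a • xi + b • Ntr) →
    ∃ a b : F, Dperp X V = a • xi + b • Ntr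
  Ds_screen : ∀ X Y, screen X → screen Y → screen (Ds X Y)

namespace ScreenNullHyp

variable {F : Type*} [CommRing F] {VF : Type*} [AddCommGroup VF] [Module F VF]

/-- `V` is a section of the normal bundle `TM^{*⊥} = TM^⊥ ⊕ tr(TM)` of the leaf `M*`. -/
def normal (S : ScreenNullHyp F VF) (V : VF) : Prop :=
  ∃ a b : F, V = a • S.xi + b • S.Ntr

/-- the screen distribution `S(TM)` is integrable -/
def screenIntegrable (S : ScreenNullHyp F VF) : Prop :=
  ∀ X Y, S.screen X → S.screen Y → S.screen (S.bracket X Y)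

/-- the normal curvature tensor `R^{*⊥}` of the leaf `M*`:
`R^{*⊥}(X,Y)V = ∇^{*⊥}_X ∇^{*⊥}_Y V − ∇^{*⊥}_Y ∇^{*⊥}_X V − ∇^{*⊥}_{[X,Y]} V` -/
def Rperp (S : ScreenNullHyp F VF) (X Y V : VF) : VF :=
  S.Dperp X (S.Dperp Y V) - S.Dperp Y (S.Dperp X V) - S.Dperp (S.bracket X Y) V

/-- the curvature tensor `R̄` of the ambient connection `∇̄` -/
def Rbar (S : ScreenNullHyp F VF) (X Y Z : VF) : VF :=
  S.Dbar X (S.Dbar Y Z) - S.Dbar Y (S.Dbar X Z) - S.Dbar (S.bracket X Y) Z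

/-- `2dτ(X,Y) = Xτ(Y) − Yτ(X) − τ([X,Y])` -/
def twoDtau (S : ScreenNullHyp F VF) (X Y : VF) : F :=
  S.act X (S.tau Y) - S.act Y (S.tau X) - S.tau (S.bracket X Y)

/-- the ambient manifold `M̄(c)` has constant sectional curvature `c`:
`R̄(X,Y)Z = c{ḡ(Y,Z)X − ḡ(X,Z)Y}` -/
def hasConstCurv (S : ScreenNullHyp F VF) (c : F) : Prop :=
  ∀ X Y Z, S.tangent X → S.tangent Y →
    S.Rbar X Y Z = c • (S.gbar Y Z • X - S.gbar X Z • Y)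

end ScreenNullHyp

namespace ScreenNullHyp

variable {F : Type*} [CommRing F] {VF : Type*} [AddCommGroup VF] [Module F VF]
  (S : ScreenNullHyp F VF)

theorem gbar_screen_Ntr {W : VF} (hW : S.screen W) : S.gbar W S.Ntr = 0 := by
  rw [S.gbar_symm, S.gbar_Ntr_screen W hW]

theorem gbar_tangent_xi {W : VF} (hW : S.tangent W) : S.gbar W S.xi = 0 := by
  rw [S.gbar_symm, S.gbar_xi_tangent W hW]

theorem gbar_xi_Ntr : S.gbar S.xi S.Ntr = 1 := by
  rw [S.gbar_symm, S.gbar_Ntr_xi]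

/-- The null frame `ξ, N` reads off the coefficients of a normal field. -/
theorem normal.eq_gbar_smul {V : VF} (hV : S.normal V) :
    V = S.gbar V S.Ntr • S.xi + S.gbar V S.xi • S.Ntr := by
  obtain ⟨a, b, rfl⟩ := hV
  simp [S.gbar_xi_Ntr, S.gbar_Ntr_Ntr, S.gbar_Ntr_xi, S.gbar_tangent_xi S.tangent_xi]

theorem normal.sub {V W : VF} (hV : S.normal V) (hW : S.normal W) : S.normal (V - W) := by
  obtain ⟨a, b, rfl⟩ := hV
  obtain ⟨a', b', rfl⟩ := hW
  exact ⟨a - a', b - b', by module⟩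

theorem gbar_Dbar_Ntr {X V : VF} (hX : S.screen X) (hV : S.normal V) :
    S.gbar (S.Dbar X V) S.Ntr = S.gbar (S.Dperp X V) S.Ntr := by
  rw [S.leaf_weingarten X V hX hV]
  simp [S.gbar_screen_Ntr (S.Ash_screen V X hX)]

theorem gbar_Dbar_xi {X V : VF} (hX : S.screen X) (hV : S.normal V) :
    S.gbar (S.Dbar X V) S.xi = S.gbar (S.Dperp X V) S.xi := by
  rw [S.leaf_weingarten X V hX hV]
  simp [S.gbar_tangent_xi (S.screen_tangent _ (S.Ash_screen V X hX))]

/-- `∇̄` is a metric connection: fields with the same product with `Z` have derivatives whose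
products with `Z` differ by a term in `∇̄_X Z`. -/
theorem gbar_Dbar_sub_gbar_Dbar {X U U' Z : VF} (hX : S.tangent X)
    (h : S.gbar U Z = S.gbar U' Z) :
    S.gbar (S.Dbar X U) Z - S.gbar (S.Dbar X U') Z = S.gbar (U' - U) (S.Dbar X Z) := by
  have h₁ := S.metric_compat X U Z hX
  have h₂ := S.metric_compat X U' Z hX
  rw [h, h₂] at h₁
  rw [map_sub, LinearMap.sub_apply]
  linear_combination -h₁

theorem gbar_screen_Dbar_Ntr {X W : VF} (hX : S.tangent X) (hW : S.screen W) :
    S.gbar W (S.Dbar X S.Ntr) = -S.C X W := by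
  have h := S.C_shape X W hX (S.screen_tangent W hW)
  rw [S.P_id W hW, S.gbar_symm] at h
  simp [S.weingarten_Ntr X hX, S.gbar_screen_Ntr hW, h]

theorem gbar_screen_Dbar_xi {X W : VF} (hX : S.tangent X) (hW : S.screen W) :
    S.gbar W (S.Dbar X S.xi) = -S.B X W := by
  have hW' := S.screen_tangent W hW
  have h := S.B_shape X W hX hW'
  rw [S.gbar_symm] at h
  simp [S.gauss X S.xi hX S.tangent_xi, S.weingarten_xi X hX, S.gbar_screen_Ntr hW,
    S.gbar_tangent_xi hW', h]

theorem Dperp_sub_Dbar {X V : VF} (hX : S.screen X) (hV : S.normal V) :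
    S.Dperp X V - S.Dbar X V = S.Ash V X := by
  rw [S.leaf_weingarten X V hX hV]
  abel

theorem gbar_Dbar_Dbar_Ntr {X Y V : VF} (hX : S.screen X) (hY : S.screen Y)
    (hV : S.normal V) :
    S.gbar (S.Dbar X (S.Dbar Y V)) S.Ntr
      = S.gbar (S.Dperp X (S.Dperp Y V)) S.Ntr - S.C X (S.Ash V Y) := by
  have hX' := S.screen_tangent X hX
  have h := S.gbar_Dbar_sub_gbar_Dbar hX' (S.gbar_Dbar_Ntr hY hV)
  rw [S.Dperp_sub_Dbar hY hV, S.gbar_screen_Dbar_Ntr hX' (S.Ash_screen V Y hY),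
    S.gbar_Dbar_Ntr hX (S.Dperp_normal Y V hY hV)] at h
  linear_combination h

theorem gbar_Dbar_Dbar_xi {X Y V : VF} (hX : S.screen X) (hY : S.screen Y)
    (hV : S.normal V) :
    S.gbar (S.Dbar X (S.Dbar Y V)) S.xi
      = S.gbar (S.Dperp X (S.Dperp Y V)) S.xi - S.B X (S.Ash V Y) := by
  have hX' := S.screen_tangent X hX
  have h := S.gbar_Dbar_sub_gbar_Dbar hX' (S.gbar_Dbar_xi hY hV)
  rw [S.Dperp_sub_Dbar hY hV, S.gbar_screen_Dbar_xi hX' (S.Ash_screen V Y hY),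
    S.gbar_Dbar_xi hX (S.Dperp_normal Y V hY hV)] at h
  linear_combination h

end ScreenNullHyp

/-- part of Proposition 3.2. Let `(M,g)` be a screen integrable null
hypersurface of a Lorentzian manifold `M̄(c)` of constant sectional curvature `c`, and `M*` a
leaf of `S(TM)` immersed in `M̄` as a codimension-2 submanifold.  Then for all
`X, Y ∈ Γ(TM*)` and every normal vector field `V` to `M*`, the normal curvature satisfies
`R^{*⊥}(X,Y)V = {C(X,A_V Y) − C(Y,A_V X)}ξ + {B(X,A_V Y) − B(Y,A_V X)}N`. -/
theorem normal_curvature_eq_second_fundamental_forms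
    {F : Type*} [CommRing F] {VF : Type*} [AddCommGroup VF] [Module F VF]
    (S : ScreenNullHyp F VF) (hint : S.screenIntegrable)
    (c : F) (hc : S.hasConstCurv c)
    (X Y V : VF) (hX : S.screen X) (hY : S.screen Y) (hV : S.normal V) :
    S.Rperp X Y V
      = (S.C X (S.Ash V Y) - S.C Y (S.Ash V X)) • S.xi
        + (S.B X (S.Ash V Y) - S.B Y (S.Ash V X)) • S.Ntr := by
  have hXY := hint X Y hX hY
  have hR : S.normal (S.Rperp X Y V) :=
    .sub S (.sub S (S.Dperp_normal X _ hX (S.Dperp_normal Y V hY hV))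
      (S.Dperp_normal Y _ hY (S.Dperp_normal X V hX hV))) (S.Dperp_normal _ V hXY hV)
  have hcurv := hc X Y V (S.screen_tangent X hX) (S.screen_tangent Y hY)
  have hN : S.gbar (S.Rbar X Y V) S.Ntr = 0 := by
    simp [hcurv, S.gbar_screen_Ntr hX, S.gbar_screen_Ntr hY]
  have hxi : S.gbar (S.Rbar X Y V) S.xi = 0 := by
    simp [hcurv, S.gbar_tangent_xi (S.screen_tangent X hX),
      S.gbar_tangent_xi (S.screen_tangent Y hY)]
  simp only [ScreenNullHyp.Rbar, map_sub, LinearMap.sub_apply, S.gbar_Dbar_Dbar_Ntr hX hY hV,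
    S.gbar_Dbar_Dbar_Ntr hY hX hV, S.gbar_Dbar_Ntr hXY hV] at hN
  simp only [ScreenNullHyp.Rbar, map_sub, LinearMap.sub_apply, S.gbar_Dbar_Dbar_xi hX hY hV,
    S.gbar_Dbar_Dbar_xi hY hX hV, S.gbar_Dbar_xi hXY hV] at hxi
  rw [hR.eq_gbar_smul S]
  congr 2
  · simp only [ScreenNullHyp.Rperp, map_sub, LinearMap.sub_apply]
    linear_combination hN
  · simp only [ScreenNullHyp.Rperp, map_sub, LinearMap.sub_apply]
    linear_combination hxi
end

section
/- Let (M,g) be a screen integrable null hypersurface of a Lorentzian manifold, and M* a leaf of S(TM) isometrically immersed in the ambient space as a codimension-2 submanifold with orthonormal normal frame {V,W}. If M* is minimal in the ambient space (its mean curvature vector H* = ½[(trace A_V)V + (trace A_W)W] vanishes, equivalently trace A_V = 0 and trace A_W = 0), then the null hypersurface (M,g) is minimal, i.e. trace_{S(TM)} A*_ξ = 0. -/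
namespace ScreenNullHyp

variable {F : Type*} [CommRing F] {VF : Type*} [AddCommGroup VF] [Module F VF]

theorem act_zero (S : ScreenNullHyp F VF) {X : VF} (hX : S.tangent X) : S.act X 0 = 0 := by
  simpa using S.metric_compat X 0 0 hX

/-- Normal sections are orthogonal to the screen distribution. -/
theorem normal.gbar_screen {S : ScreenNullHyp F VF} {V Y : VF} (hV : S.normal V)
    (hY : S.screen Y) : S.gbar V Y = 0 := by
  obtain ⟨a, b, rfl⟩ := hV
  simp [S.gbar_xi_tangent Y (S.screen_tangent Y hY), S.gbar_Ntr_screen Y hY]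

theorem normal_xi (S : ScreenNullHyp F VF) : S.normal S.xi := ⟨1, 0, by simp⟩

theorem normal_Ntr (S : ScreenNullHyp F VF) : S.normal S.Ntr := ⟨0, 1, by simp⟩

theorem gbar_Dbar_of_normal (S : ScreenNullHyp F VF) {V X Y : VF} (hV : S.normal V)
    (hX : S.tangent X) (hY : S.screen Y) :
    S.gbar V (S.Dbar X Y) = -S.gbar (S.Dbar X V) Y := by
  have h := S.metric_compat X V Y hX
  rw [hV.gbar_screen hY, S.act_zero hX] at h
  linear_combination -h

theorem gbar_xi_Dbar (S : ScreenNullHyp F VF) {X Y : VF} (hX : S.tangent X) (hY : S.screen Y) :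
    S.gbar S.xi (S.Dbar X Y) = S.gbar (S.Axi X) Y := by
  rw [S.gbar_Dbar_of_normal S.normal_xi hX hY, S.gauss X S.xi hX S.tangent_xi,
    S.weingarten_xi X hX]
  simp [S.normal_xi.gbar_screen hY, S.normal_Ntr.gbar_screen hY]

theorem gbar_Ntr_Dbar (S : ScreenNullHyp F VF) {X Y : VF} (hX : S.tangent X) (hY : S.screen Y) :
    S.gbar S.Ntr (S.Dbar X Y) = S.gbar (S.AN X) Y := by
  rw [S.gbar_Dbar_of_normal S.normal_Ntr hX hY, S.weingarten_Ntr X hX]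
  simp [S.normal_Ntr.gbar_screen hY]

/-- `g(A_V X, Y) = a g(A*_ξ X, Y) + b g(A_N X, Y)` for `V = aξ + bN`. -/
theorem gbar_Ash (S : ScreenNullHyp F VF) (a b : F) {X Y : VF} (hX : S.screen X)
    (hY : S.screen Y) :
    S.gbar (S.Ash (a • S.xi + b • S.Ntr) X) Y
      = a * S.gbar (S.Axi X) Y + b * S.gbar (S.AN X) Y := by
  have hV : S.normal (a • S.xi + b • S.Ntr) := ⟨a, b, rfl⟩
  have hXt := S.screen_tangent X hX
  have h := S.gbar_Dbar_of_normal hV hXt hY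
  have hD : S.normal (S.Dperp X (a • S.xi + b • S.Ntr)) := S.Dperp_normal X _ hX hV
  rw [S.leaf_weingarten X _ hX hV] at h
  simp only [map_add, map_neg, map_smul, LinearMap.add_apply, LinearMap.neg_apply,
    LinearMap.smul_apply, smul_eq_mul, hD.gbar_screen hY, S.gbar_xi_Dbar hXt hY,
    S.gbar_Ntr_Dbar hXt hY] at h
  linear_combination -h

theorem gbar_normal_normal (S : ScreenNullHyp F VF) (a b c d : F) :
    S.gbar (a • S.xi + b • S.Ntr) (c • S.xi + d • S.Ntr) = a * d + b * c := by
  simp [S.gbar_xi_tangent S.xi S.tangent_xi, S.gbar_symm S.xi S.Ntr, S.gbar_Ntr_xi,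
    S.gbar_Ntr_Ntr]

end ScreenNullHyp

/-- Let `(M,g)` be a screen integrable null hypersurface of a Lorentzian
manifold and `M*` a leaf of `S(TM)` isometrically immersed as a codimension-2 submanifold
with an orthonormal normal frame `{V, W}` (one spacelike, one timelike).  If `M*` is
minimal in the ambient space, i.e. its mean curvature vector
`H* = ½[(trace A_V)V + (trace A_W)W]` vanishes (equivalently `trace A_V = 0` and
`trace A_W = 0`), then the null hypersurface `(M,g)` is minimal:
`trace_{S(TM)} A*_ξ = 0`.  Traces are computed with respect to an orthonormal frame
`E 0, …, E (n-1)` spanning the screen distribution. -/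
theorem null_hypersurface_minimal_of_leaf_minimal
    {F : Type*} [CommRing F] {VF : Type*} [AddCommGroup VF] [Module F VF]
    (S : ScreenNullHyp F VF) (hint : S.screenIntegrable)
    (n : ℕ) (E : Fin n → VF) (hE : ∀ i, S.screen (E i))
    (hEon : ∀ i j, S.gbar (E i) (E j) = if i = j then 1 else 0)
    (hEspan : ∀ X, S.screen X → ∃ cf : Fin n → F, X = ∑ i, cf i • E i)
    (V W : VF) (hV : S.normal V) (hW : S.normal W)
    (hVV : S.gbar V V = 1) (hWW : S.gbar W W = -1) (hVW : S.gbar V W = 0)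
    (hminV : ∑ i, S.gbar (S.Ash V (E i)) (E i) = 0)
    (hminW : ∑ i, S.gbar (S.Ash W (E i)) (E i) = 0) :
    ∑ i, S.gbar (S.Axi (E i)) (E i) = 0 := by
  obtain ⟨a, b, rfl⟩ := hV
  obtain ⟨c, d, rfl⟩ := hW
  rw [S.gbar_normal_normal] at hVV hWW hVW
  simp only [S.gbar_Ash _ _ (hE _) (hE _), Finset.sum_add_distrib, ← Finset.mul_sum]
    at hminV hminW
  set p := ∑ i, S.gbar (S.Axi (E i)) (E i)
  have hdet : (a * d - b * c) ^ 2 = 1 := by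
    linear_combination (a * d + b * c) * hVW - 2 * c * d * hVV - hWW
  linear_combination (a * d - b * c) * (d * hminV - b * hminW) - p * hdet
end
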